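/- arXiv:2410.04394 — 2 statements merged into one kernel-verified Lean document; each statement's English description precedes it below -/
import Mathlib

section
/- Let q ≥ 2, C ≥ 1, let d ≥ 3 be an integer, let α, ε ∈ (0,1], L ≥ 1, and let G be a d-regular simple graph on [n] satisfying the long-range expansion property Expan(α,ε,L). Let k ≥ 1, let ‖·‖_X be a 1-unconditional norm on ℝ^k, and let f : [n] → {−1,0,1}^k satisfy min{|{v ∈ [n] : f(v)_j ≥ 0}|, |{v ∈ [n] : f(v)_j ≤ 0}|} ≥ n/2 for all j ∈ [k], and assume the collection {P_J(|f(v)|) : v ∈ [n], J ⊆ [k]} has restricted cotype q with constant C. Set L̃ := 2·(20dL/(αε))^8 and suppose that for every v ∈ [n] and j with f(v)_j ≠ 0 we are given Ẽ(v,j) ⊆ E(v,j;ℓ_{v,j}) with |Ẽ(v,j)| ≥ (α·a_{ℓ_{v,j}}/12)(d−1)^{ℓ_{v,j}−1}, and such that for every j ∈ [k], ℓ ≥ 1 and e ∈ E_G, |{v ∈ [n] : j ∈ J(v,ℓ,e)}| ≤ 2L̃(d−1−ε)^ℓ. Let b ∈ ℤ, let ℓ ≥ 1, set M(b,ℓ)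 := {v ∈ [n] : ‖P_{J(v,ℓ)}(f(v))‖_X ≥ 2^b} and ĉ := α³/(2^15 · d³ · C · L̃^{1/q}). Then either (i) the number of edges {w,w'} ∈ E_G with ‖f(w)−f(w')‖_X ≥ ĉ·a_ℓ·2^b is at least |M(b,ℓ)|/a_ℓ², or (ii) the number of edges {w,w'} ∈ E_G with ‖f(w)−f(w')‖_X ≥ ĉ·a_ℓ³·2^b·((d−1)/(d−1−ε))^{ℓ/q} is at least ĉ·a_ℓ·|M(b,ℓ)|. -/
open Finset

attribute [local instance] Classical.propDecidable

noncomputable section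

/-- Distance (in `ℕ∞`) from a vertex to a finite set of vertices. -/
def vertexSetDist {n : ℕ} (G : SimpleGraph (Fin n)) (v : Fin n) (S : Finset (Fin n)) : ℕ∞ :=
  S.inf fun w => G.edist v w

/-- Distance (in `ℕ∞`) from a vertex to an (unordered) edge. -/
def edgeDist {n : ℕ} (G : SimpleGraph (Fin n)) (v : Fin n) (e : Sym2 (Fin n)) : ℕ∞ :=
  Sym2.lift ⟨fun a b => min (G.edist v a) (G.edist v b), fun _ _ => min_comm _ _⟩ e

/-- Distance (in `ℕ∞`) from an (unordered) edge to a finite set of vertices. -/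
def edgeSetDist {n : ℕ} (G : SimpleGraph (Fin n)) (e : Sym2 (Fin n)) (S : Finset (Fin n)) : ℕ∞ :=
  S.inf fun v => edgeDist G v e

/-- Part (A) of the long-range expansion property. -/
def ExpanA (n d : ℕ) (G : SimpleGraph (Fin n)) (α : ℝ) : Prop :=
  ∀ S : Finset (Fin n), S.Nonempty → ∀ ℓ : ℕ, 1 ≤ ℓ →
    min (3 * (n : ℝ) / 4) (α * ((d : ℝ) - 1) ^ ℓ * S.card) ≤
      ((univ.filter fun v => vertexSetDist G v S ≤ (ℓ : ℕ∞)).card : ℝ)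

/-- Part (B) of the long-range expansion property. -/
def ExpanB (n d : ℕ) (G : SimpleGraph (Fin n)) [DecidableRel G.Adj] (α ε L : ℝ) : Prop :=
  ∀ S : Finset (Fin n), S.Nonempty → ∀ ℓ : ℕ, 1 ≤ ℓ →
    α * ((d : ℝ) - 1) ^ (ℓ - 1) * S.card ≤ 3 * n / 4 →
    ∃ v ∈ S,
      (((G.edgeFinset.filter fun e =>
            L * ((d : ℝ) - 1 - ε) ^ ℓ ≤
              ((S.filter fun u => edgeDist G u e ≤ ((ℓ - 1 : ℕ) : ℕ∞)).card : ℝ)).filter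
          fun e => edgeDist G v e ≤ ((ℓ - 1 : ℕ) : ℕ∞)).card : ℝ) ≤
        L * ((d : ℝ) - 1 - ε) ^ ℓ

/-- The long-range expansion property `Expan(α, ε, L)`. -/
def Expan (n d : ℕ) (G : SimpleGraph (Fin n)) [DecidableRel G.Adj] (α ε L : ℝ) : Prop :=
  ExpanA n d G α ∧ ExpanB n d G α ε L

/-- `N` is a norm on `ℝ^k`. -/
def IsNorm (k : ℕ) (N : (Fin k → ℝ) → ℝ) : Prop :=
  (∀ x, N x = 0 ↔ x = 0) ∧ (∀ (c : ℝ) (x), N (c • x) = |c| * N x) ∧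
    ∀ x y, N (x + y) ≤ N x + N y

/-- The standard basis of `ℝ^k` is `K`-unconditional for `N`. -/
def UncondConst (k : ℕ) (N : (Fin k → ℝ) → ℝ) (K : ℝ) : Prop :=
  ∀ (σ : Fin k → Bool) (a : Fin k → ℝ),
    N (fun j => (if σ j then (1 : ℝ) else -1) * a j) ≤ K * N a

/-- `N` is a `1`-unconditional norm on `ℝ^k`: `‖y‖ = ‖|y|‖`. -/
def OneUnconditional (k : ℕ) (N : (Fin k → ℝ) → ℝ) : Prop :=
  ∀ y, N y = N fun j => |y j|

/-- `N` has cotype `q` with constant `C`. -/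
def HasCotype (k : ℕ) (N : (Fin k → ℝ) → ℝ) (q C : ℝ) : Prop :=
  ∀ (m : ℕ) (x : Fin m → Fin k → ℝ),
    1 / C ^ q * ∑ i, N (x i) ^ q ≤
      1 / 2 ^ m * ∑ σ : Fin m → Bool, N (∑ i, (if σ i then (1 : ℝ) else -1) • x i) ^ q

/-- The collection of vectors `Y` has restricted cotype `q` with constant `C` w.r.t. `N`. -/
def RestrictedCotype (k : ℕ) (N : (Fin k → ℝ) → ℝ) (q C : ℝ) (Y : Set (Fin k → ℝ)) : Prop :=
  ∀ (m : ℕ), 0 < m → ∀ y : Fin m → Fin k → ℝ, Function.Injective y → (∀ i, y i ∈ Y) →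
    1 / C ^ q * ∑ i, N (y i) ^ q ≤
      1 / 2 ^ m * ∑ σ : Fin m → Bool, N (∑ i, (if σ i then (1 : ℝ) else -1) • y i) ^ q

/-- For an edge `e = {a, b}`, the value `N (f a - f b)` (well-defined when `N` is a norm). -/
def edgeNorm {n k : ℕ} (N : (Fin k → ℝ) → ℝ) (f : Fin n → Fin k → ℝ) (e : Sym2 (Fin n)) : ℝ :=
  Sym2.lift ⟨fun a b => min (N (f a - f b)) (N (f b - f a)), fun _ _ => min_comm _ _⟩ e

/-- Coordinate projection `P_J`. -/
def proj {k : ℕ} (J : Finset (Fin k)) (y : Fin k → ℝ) : Fin k → ℝ :=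
  fun j => if j ∈ J then y j else 0

/-- Indicator vector `χ_J ∈ ℝ^k`. -/
def chi {k : ℕ} (J : Finset (Fin k)) : Fin k → ℝ := fun j => if j ∈ J then 1 else 0

/-- The sequence `a_ℓ = (6/π²) ℓ⁻²`. -/
def aseq (ℓ : ℕ) : ℝ := 6 / Real.pi ^ 2 * (1 / (ℓ : ℝ) ^ 2)

/-- The set of edges `E(S, j; ℓ)`: edges within distance `ℓ - 1` of `S` with a jump in the
`j`-th coordinate. -/
def jumpEdges {n k : ℕ} (G : SimpleGraph (Fin n)) [DecidableRel G.Adj]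
    (f : Fin n → Fin k → ℝ) (j : Fin k) (S : Finset (Fin n)) (ℓ : ℕ) :
    Finset (Sym2 (Fin n)) :=
  G.edgeFinset.filter fun e =>
    edgeSetDist G e S ≤ ((ℓ - 1 : ℕ) : ℕ∞) ∧
      Sym2.lift ⟨fun a b => f a j ≠ f b j, fun _ _ => propext ne_comm⟩ e

/-- The scale `ℓ_{v,j}`. -/
def lvj {n k : ℕ} (G : SimpleGraph (Fin n)) [DecidableRel G.Adj]
    (f : Fin n → Fin k → ℝ) (α : ℝ) (d : ℕ) (v : Fin n) (j : Fin k) : ℕ :=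
  sInf {ℓ : ℕ | 1 ≤ ℓ ∧
    α * aseq ℓ / 6 * ((d : ℝ) - 1) ^ (ℓ - 1) ≤ ((jumpEdges G f j {v} ℓ).card : ℝ)}

/-- The set `V_+(j; ℓ)`. -/
def Vplus {n k : ℕ} (G : SimpleGraph (Fin n)) [DecidableRel G.Adj]
    (f : Fin n → Fin k → ℝ) (α : ℝ) (d : ℕ) (j : Fin k) (ℓ : ℕ) : Finset (Fin n) :=
  univ.filter fun v => f v j = 1 ∧ lvj G f α d v j = ℓ

/-- The set `V_-(j; ℓ)`. -/
def Vminus {n k : ℕ} (G : SimpleGraph (Fin n)) [DecidableRel G.Adj]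
    (f : Fin n → Fin k → ℝ) (α : ℝ) (d : ℕ) (j : Fin k) (ℓ : ℕ) : Finset (Fin n) :=
  univ.filter fun v => f v j = -1 ∧ lvj G f α d v j = ℓ

/-- The scale-`ℓ` support `J(v, ℓ)`. -/
def Jset {n k : ℕ} (G : SimpleGraph (Fin n)) [DecidableRel G.Adj]
    (f : Fin n → Fin k → ℝ) (α : ℝ) (d : ℕ) (v : Fin n) (ℓ : ℕ) : Finset (Fin k) :=
  univ.filter fun j => f v j ≠ 0 ∧ lvj G f α d v j = ℓ

/-- The scale-`ℓ` mutual support `J(v, ℓ, e)`, relative to a family `Ẽ(v, j)` of edge sets. -/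
def JsetE {n k : ℕ} (G : SimpleGraph (Fin n)) [DecidableRel G.Adj]
    (f : Fin n → Fin k → ℝ) (α : ℝ) (d : ℕ) (Et : Fin n → Fin k → Finset (Sym2 (Fin n)))
    (v : Fin n) (ℓ : ℕ) (e : Sym2 (Fin n)) : Finset (Fin k) :=
  (Jset G f α d v ℓ).filter fun j => e ∈ Et v j

end

theorem aux_update {k : ℕ} {N : (Fin k → ℝ) → ℝ} (hN : IsNorm k N) (hunc : OneUnconditional k N)
    (y : Fin k → ℝ) (i : Fin k) (t : ℝ) (ht : |t| ≤ |y i|) :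
    N (Function.update y i t) ≤ N y := by
  by_cases h0 : y i = 0
  · have : t = y i := by
      rw [h0, abs_zero] at ht
      rw [h0]; exact abs_nonpos_iff.mp ht
    rw [this, Function.update_eq_self]
  · set y' := Function.update y i (-(y i)) with hy'
    have hNy : N y' = N y := by
      rw [hunc y', hunc y]
      congr 1
      funext j
      by_cases hj : j = i
      · subst hj; simp [hy']
      · simp [hy', hj]
    set s := t / y i with hs
    have hs1 : |s| ≤ 1 := by
      rw [hs, abs_div]
      exact div_le_one_of_le₀ ht (abs_nonneg _)
    have hts : t = s * y i := by rw [hs]; field_simp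
    obtain ⟨h1, h2⟩ := abs_le.mp hs1
    have hdec : Function.update y i t = ((1 + s) / 2) • y + ((1 - s) / 2) • y' := by
      funext j
      by_cases hj : j = i
      · subst hj; simp [hy', hts]; ring
      · simp [hy', hj]; ring
    rw [hdec]
    refine (hN.2.2 _ _).trans ?_
    rw [hN.2.1, hN.2.1, hNy, abs_of_nonneg (by linarith), abs_of_nonneg (by linarith)]
    linarith

theorem aux_mono {k : ℕ} {N : (Fin k → ℝ) → ℝ} (hN : IsNorm k N) (hunc : OneUnconditional k N)
    (x y : Fin k → ℝ) (h : ∀ j, |x j| ≤ |y j|) : N x ≤ N y := by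
  have key : ∀ S : Finset (Fin k), N (fun j => if j ∈ S then x j else y j) ≤ N y := by
    intro S
    induction S using Finset.induction_on with
    | empty => simp
    | insert i S hi ih =>
      refine le_trans ?_ ih
      have := aux_update hN hunc (fun j => if j ∈ S then x j else y j) i (x i) (by simpa [hi] using h i)
      refine le_trans (le_of_eq ?_) this
      congr 1
      funext j
      by_cases hj : j = i
      · subst hj; simp
      · simp [hj]
  simpa using key univ

theorem aux_nonneg {k : ℕ} {N : (Fin k → ℝ) → ℝ} (hN : IsNorm k N) (hunc : OneUnconditional k N)
    (x : Fin k → ℝ) : 0 ≤ N x := by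
  have h0 : N 0 = 0 := (hN.1 0).2 rfl
  rw [← h0]
  exact aux_mono hN hunc _ _ (by intro j; simp)

theorem aux_sum {k : ℕ} {N : (Fin k → ℝ) → ℝ} (hN : IsNorm k N) {ι : Type*} (s : Finset ι)
    (g : ι → Fin k → ℝ) : N (∑ i ∈ s, g i) ≤ ∑ i ∈ s, N (g i) := by
  induction s using Finset.induction_on with
  | empty => simp [(hN.1 0).2 rfl]
  | insert i s hi ih =>
    rw [Finset.sum_insert hi, Finset.sum_insert hi]
    exact (hN.2.2 _ _).trans (by linarith)

theorem aux_step1 {n k : ℕ} {N : (Fin k → ℝ) → ℝ} {q C x : ℝ} (hq : 2 ≤ q) (hC : 1 ≤ C)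
    (hN : IsNorm k N) (hunc : OneUnconditional k N)
    (f : Fin n → Fin k → ℝ) (hf : ∀ v j, |f v j| ≤ 1)
    (hrc : RestrictedCotype k N q C
      {y | ∃ (v : Fin n) (J : Finset (Fin k)), y = proj J fun j => |f v j|})
    (Js : Fin n → Finset (Fin k))
    (hx : ∀ z : Fin k → ℝ, (∀ j, |z j| ≤ 1) → (∀ j, z j ≠ 0 → ∃ v, j ∈ Js v) → N z ≤ x)
    (A : Finset (Fin n)) (Jp : Fin n → Finset (Fin k)) (hsub : ∀ v, Jp v ⊆ Js v)
    (hdis : ∀ u ∈ A, ∀ v ∈ A, u ≠ v → Disjoint (Jp u) (Jp v)) :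
    ∑ v ∈ A, N (proj (Jp v) fun j => |f v j|) ^ q ≤ C ^ q * x ^ q := by
  have hN0 : N 0 = 0 := (hN.1 0).2 rfl
  have hx0 : 0 ≤ x := by
    have := hx 0 (by simp) (by simp)
    linarith
  have hCq : 0 < C ^ q := Real.rpow_pos_of_pos (by linarith) _
  set A' := A.filter fun v => (proj (Jp v) fun j => |f v j|) ≠ 0 with hA'
  have hsum : ∑ v ∈ A, N (proj (Jp v) fun j => |f v j|) ^ q
      = ∑ v ∈ A', N (proj (Jp v) fun j => |f v j|) ^ q := by
    symm
    apply Finset.sum_subset (Finset.filter_subset _ _)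
    intro v hv hv'
    have : (proj (Jp v) fun j => |f v j|) = 0 := by
      by_contra h; exact hv' (by simp [A', hv, h])
    rw [this, hN0, Real.zero_rpow (by linarith)]
  rw [hsum]
  rcases Finset.eq_empty_or_nonempty A' with h | h
  · rw [h]; simp; positivity
  set m := A'.card with hm
  let E := A'.equivFin
  let y : Fin m → Fin k → ℝ := fun i => proj (Jp (E.symm i).1) fun j => |f (E.symm i).1 j|
  have hmem : ∀ i, (E.symm i).1 ∈ A ∧ y i ≠ 0 := fun i => by
    exact Finset.mem_filter.mp (E.symm i).2
  -- disjointness in coordinates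
  have hd : ∀ i i' j, y i j ≠ 0 → y i' j ≠ 0 → i = i' := by
    intro i i' j h1 h2
    by_contra hne
    have hne' : (E.symm i).1 ≠ (E.symm i').1 := fun hh => hne (E.symm.injective (Subtype.ext hh))
    have := hdis _ (hmem i).1 _ (hmem i').1 hne'
    have a1 : j ∈ Jp (E.symm i).1 := by
      by_contra hh; exact h1 (by simp [y, proj, hh])
    have a2 : j ∈ Jp (E.symm i').1 := by
      by_contra hh; exact h2 (by simp [y, proj, hh])
    exact Finset.disjoint_left.mp this a1 a2
  have hyb : ∀ i j, |y i j| ≤ 1 := by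
    intro i j
    simp only [y, proj]
    split_ifs
    · rw [abs_abs]; exact hf _ _
    · simp
  have hinj : Function.Injective y := by
    intro i i' hii
    obtain ⟨j, hj⟩ : ∃ j, y i j ≠ 0 := by
      by_contra hh; push Not at hh
      exact (hmem i).2 (funext hh)
    exact hd i i' j hj (hii ▸ hj)
  have hc := hrc m h.card_pos y hinj (fun i => ⟨_, _, rfl⟩)
  have hs : ∀ σ : Fin m → Bool, N (∑ i, (if σ i then (1 : ℝ) else -1) • y i) ^ q ≤ x ^ q := by
    intro σ
    apply Real.rpow_le_rpow (aux_nonneg hN hunc _) _ (by linarith)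
    apply hx
    · intro j
      simp only [Finset.sum_apply, Pi.smul_apply, smul_eq_mul]
      by_cases hex : ∃ i, y i j ≠ 0
      · obtain ⟨i, hi⟩ := hex
        rw [Finset.sum_eq_single i]
        · rw [abs_mul]
          have : |if σ i = true then (1 : ℝ) else -1| = 1 := by split_ifs <;> simp
          rw [this, one_mul]; exact hyb i j
        · intro b _ hb
          have : y b j = 0 := by
            by_contra hh; exact hb (hd b i j hh hi)
          rw [this, mul_zero]
        · simp
      · push Not at hex
        simp [hex]
    · intro j hj
      simp only [Finset.sum_apply, Pi.smul_apply, smul_eq_mul] at hj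
      obtain ⟨i, _, hi⟩ := Finset.exists_ne_zero_of_sum_ne_zero hj
      refine ⟨(E.symm i).1, hsub _ ?_⟩
      by_contra hh
      exact hi (by simp [y, proj, hh])
  have hs2 : 1 / 2 ^ m * ∑ σ : Fin m → Bool, N (∑ i, (if σ i then (1 : ℝ) else -1) • y i) ^ q
      ≤ x ^ q := by
    have := Finset.sum_le_card_nsmul univ
      (fun σ : Fin m → Bool => N (∑ i, (if σ i then (1 : ℝ) else -1) • y i) ^ q) (x ^ q)
      (fun σ _ => hs σ)
    simp only [Finset.card_univ, Fintype.card_fun, Fintype.card_bool, Fintype.card_fin,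
      nsmul_eq_mul] at this
    push_cast at this
    rw [one_div, inv_mul_le_iff₀ (by positivity)]
    exact this
  have hsy : ∑ v ∈ A', N (proj (Jp v) fun j => |f v j|) ^ q = ∑ i, N (y i) ^ q := by
    rw [← Finset.sum_coe_sort]
    exact (Equiv.sum_comp E.symm (fun v : A' => N (proj (Jp v.1) fun j => |f v.1 j|) ^ q)).symm
  rw [hsy]
  have h3 := hc.trans hs2
  rw [one_div, inv_mul_le_iff₀ hCq] at h3
  exact h3

theorem aux_count {n K : ℕ} (u v : Fin n) (huv : u ≠ v) :
    (univ.filter fun c : Fin n → Fin K => c u = c v).card * K ≤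
      Fintype.card (Fin n → Fin K) := by
  have : (univ.filter fun c : Fin n → Fin K => c u = c v).card * K =
      ((univ.filter fun c : Fin n → Fin K => c u = c v) ×ˢ (univ : Finset (Fin K))).card := by
    rw [Finset.card_product]; simp
  rw [this, ← Finset.card_univ]
  apply Finset.card_le_card_of_injOn (fun p => Function.update p.1 u p.2) (by simp)
  rintro ⟨c, i⟩ hc ⟨c', i'⟩ hc' h
  simp only [Finset.coe_product, Set.mem_prod, Finset.mem_coe, Finset.mem_filter,
    Finset.mem_univ, true_and, and_true] at hc hc' h
  have hi : i = i' := by simpa using congrFun h u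
  have hw : ∀ w, w ≠ u → c w = c' w := fun w hw => by simpa [hw] using congrFun h w
  have hcc : c = c' := by
    funext w
    by_cases hwu : w = u
    · subst hwu; rw [hc, hc']; exact hw v huv.symm
    · exact hw w hwu
  rw [hi, hcc]

theorem aux_core {n k : ℕ} {N : (Fin k → ℝ) → ℝ} {q C x : ℝ} (hq : 2 ≤ q) (hC : 1 ≤ C)
    (hN : IsNorm k N) (hunc : OneUnconditional k N)
    (f : Fin n → Fin k → ℝ) (hf : ∀ v j, |f v j| ≤ 1)
    (hrc : RestrictedCotype k N q C
      {y | ∃ (v : Fin n) (J : Finset (Fin k)), y = proj J fun j => |f v j|})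
    (Js : Fin n → Finset (Fin k))
    (hx : ∀ z : Fin k → ℝ, (∀ j, |z j| ≤ 1) → (∀ j, z j ≠ 0 → ∃ v, j ∈ Js v) → N z ≤ x)
    (m : ℕ) (hm : 1 ≤ m) (hcnt : ∀ j, (univ.filter fun v => j ∈ Js v).card ≤ m) :
    ∑ v, (N (proj (Js v) fun j => |f v j|) / 2) ^ q ≤ (2 * m) * (C ^ q * x ^ q) := by
  set K := 2 * m with hK
  have : NeZero K := ⟨by omega⟩
  set Jp : (Fin n → Fin K) → Fin n → Finset (Fin k) := fun c v =>
    (Js v).filter fun j => ∀ u, u ≠ v → j ∈ Js u → c u ≠ c v with hJp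
  set T : ℝ := (Fintype.card (Fin n → Fin K) : ℝ) with hT
  have hTpos : 0 < T := by
    rw [hT]; exact_mod_cast Fintype.card_pos
  have hup : ∀ c, ∑ v, N (proj (Jp c v) fun j => |f v j|) ^ q ≤ K * (C ^ q * x ^ q) := by
    intro c
    rw [← Finset.sum_fiberwise univ c]
    refine (Finset.sum_le_card_nsmul univ _ (C ^ q * x ^ q) ?_).trans (by simp)
    intro i _
    apply aux_step1 hq hC hN hunc f hf hrc Js hx _ (Jp c) (fun v => Finset.filter_subset _ _)
    intro u hu v hv huv
    simp only [Finset.mem_filter, Finset.mem_univ, true_and] at hu hv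
    rw [Finset.disjoint_left]
    intro j h1 h2
    simp only [hJp, Finset.mem_filter] at h1 h2
    exact h2.2 u huv h1.1 (hu.trans hv.symm)
  have hlow : ∀ v, T * (N (proj (Js v) fun j => |f v j|) / 2) ^ q ≤
      ∑ c, N (proj (Jp c v) fun j => |f v j|) ^ q := by
    intro v
    have hcoord : T / 2 * N (proj (Js v) fun j => |f v j|) ≤
        ∑ c, N (proj (Jp c v) fun j => |f v j|) := by
      refine le_trans ?_ (aux_sum hN univ (fun c => proj (Jp c v) fun j => |f v j|))
      rw [show T / 2 * N (proj (Js v) fun j => |f v j|)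
        = N ((T / 2) • (proj (Js v) fun j => |f v j|)) by
          rw [hN.2.1, abs_of_pos (by positivity)]]
      apply aux_mono hN hunc
      intro j
      simp only [Pi.smul_apply, Finset.sum_apply, smul_eq_mul]
      by_cases hj : j ∈ Js v
      swap
      · simp [proj, hj]
      have hbad : (univ.filter fun c : Fin n → Fin K => ¬ j ∈ Jp c v).card * 2 ≤
          Fintype.card (Fin n → Fin K) := by
        have hsub : (univ.filter fun c : Fin n → Fin K => ¬ j ∈ Jp c v) ⊆
            (((univ.filter fun u => j ∈ Js u).erase v)).biUnion
              fun u => univ.filter fun c : Fin n → Fin K => c u = c v := by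
          intro c hc
          simp only [Finset.mem_filter, Finset.mem_univ, true_and, hJp, hj] at hc
          push Not at hc
          obtain ⟨u, hu, hju, hcu⟩ := hc
          simp only [Finset.mem_biUnion, Finset.mem_erase, Finset.mem_filter, Finset.mem_univ,
            true_and]
          exact ⟨u, ⟨hu, hju⟩, hcu⟩
        have h1 := (Finset.card_le_card hsub).trans Finset.card_biUnion_le
        have h2 : (∑ u ∈ (univ.filter fun u => j ∈ Js u).erase v,
            (univ.filter fun c : Fin n → Fin K => c u = c v).card) * K ≤
            m * Fintype.card (Fin n → Fin K) := by
          rw [Finset.sum_mul]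
          refine (Finset.sum_le_card_nsmul _ _ (Fintype.card (Fin n → Fin K)) ?_).trans ?_
          · intro u hu
            exact aux_count u v (Finset.ne_of_mem_erase hu)
          · rw [smul_eq_mul]
            exact Nat.mul_le_mul_right _
              ((Finset.card_le_card (Finset.erase_subset _ _)).trans (hcnt j))
        have h3 := (Nat.mul_le_mul_right K h1).trans h2
        have h4 : m * ((univ.filter fun c : Fin n → Fin K => ¬ j ∈ Jp c v).card * 2) ≤
          m * Fintype.card (Fin n → Fin K) := by
          refine le_trans (le_of_eq ?_) h3
          rw [show ∀ t : ℕ, t * K = t * (2 * m) from fun t => rfl]; ring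
        exact Nat.le_of_mul_le_mul_left h4 (by omega)
      have hgood : T / 2 ≤ ((univ.filter fun c : Fin n → Fin K => j ∈ Jp c v).card : ℝ) := by
        have h1 := Finset.card_filter_add_card_filter_not (s := (univ : Finset (Fin n → Fin K)))
          (fun c => j ∈ Jp c v)
        rw [Finset.card_univ] at h1
        have h2 : ((univ.filter fun c : Fin n → Fin K => j ∈ Jp c v).card : ℝ)
          + ((univ.filter fun c : Fin n → Fin K => ¬ j ∈ Jp c v).card : ℝ) = T := by
          rw [hT]; exact_mod_cast h1
        have h3 : ((univ.filter fun c : Fin n → Fin K => ¬ j ∈ Jp c v).card : ℝ) * 2 ≤ T := by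
          rw [hT]; exact_mod_cast hbad
        linarith
      have hs : ∑ c, proj (Jp c v) (fun j => |f v j|) j =
          ((univ.filter fun c : Fin n → Fin K => j ∈ Jp c v).card : ℝ) * |f v j| := by
        simp only [proj]
        rw [← Finset.sum_filter, Finset.sum_const, nsmul_eq_mul]
      rw [hs]
      simp only [proj, hj, if_true]
      rw [abs_mul, abs_mul, abs_abs, abs_of_pos (half_pos hTpos), Nat.abs_cast]
      exact mul_le_mul_of_nonneg_right hgood (abs_nonneg _)
    have hpm := Real.rpow_sum_le_const_mul_sum_rpow (univ : Finset (Fin n → Fin K))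
      (fun c => N (proj (Jp c v) fun j => |f v j|)) (p := q) (by linarith)
    simp only [abs_of_nonneg (aux_nonneg hN hunc _), Finset.card_univ] at hpm
    rw [← hT] at hpm
    have hb : 0 ≤ N (proj (Js v) fun j => |f v j|) := aux_nonneg hN hunc _
    have h5 : (T * (N (proj (Js v) fun j => |f v j|) / 2)) ^ q ≤
        T ^ (q - 1) * ∑ c, N (proj (Jp c v) fun j => |f v j|) ^ q := by
      refine le_trans (Real.rpow_le_rpow (by positivity) ?_ (by linarith)) hpm
      linarith
    rw [Real.mul_rpow hTpos.le (by positivity)] at h5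
    have h6 : T ^ q = T ^ (q - 1) * T := by
      rw [← Real.rpow_add_one hTpos.ne']; congr 1; ring
    rw [h6, mul_assoc] at h5
    exact le_of_mul_le_mul_left h5 (Real.rpow_pos_of_pos hTpos _)
  have h7 : T * ∑ v, (N (proj (Js v) fun j => |f v j|) / 2) ^ q ≤ T * (K * (C ^ q * x ^ q)) := by
    rw [Finset.mul_sum]
    refine (Finset.sum_le_sum fun v _ => hlow v).trans ?_
    rw [Finset.sum_comm]
    refine (Finset.sum_le_card_nsmul univ _ _ fun c _ => hup c).trans ?_
    rw [Finset.card_univ, nsmul_eq_mul]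
  have h8 := le_of_mul_le_mul_left h7 hTpos
  rw [hK] at h8
  push_cast at h8
  exact h8

theorem aux_pred {n : ℕ} (G : SimpleGraph (Fin n)) (v u : Fin n) (r : ℕ)
    (h : G.edist v u = ((r + 1 : ℕ) : ℕ∞)) : ∃ w, G.Adj w u ∧ G.edist v w = (r : ℕ∞) := by
  obtain ⟨p, hp⟩ := SimpleGraph.exists_walk_of_edist_eq_coe h
  have hp' : p.reverse.length = r + 1 := by simpa using hp
  generalize p.reverse = p' at hp'
  cases p' with
  | nil => simp at hp'
  | @cons _ w _ hadj p'' =>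
    simp only [SimpleGraph.Walk.length_cons, add_left_inj] at hp'
    refine ⟨w, hadj.symm, le_antisymm ?_ ?_⟩
    · rw [SimpleGraph.edist_comm]
      exact (SimpleGraph.edist_le p'').trans (by rw [hp'])
    · have h1 : G.edist v u ≤ G.edist v w + G.edist w u := SimpleGraph.edist_triangle
      rw [SimpleGraph.edist_eq_one_iff_adj.mpr hadj.symm, h] at h1
      push_cast at h1
      exact (ENat.add_le_add_iff_right (by simp)).mp h1

theorem aux_sphere {n d : ℕ} (hd : 3 ≤ d) (G : SimpleGraph (Fin n)) [DecidableRel G.Adj]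
    (hreg : ∀ v, G.degree v = d) (v : Fin n) (r : ℕ) :
    (univ.filter fun u => G.edist v u = ((r + 1 : ℕ) : ℕ∞)).card ≤ d * (d - 1) ^ r := by
  induction r with
  | zero =>
    simp only [pow_zero, mul_one]
    rw [← hreg v, ← SimpleGraph.card_neighborFinset_eq_degree]
    apply Finset.card_le_card
    intro u hu
    simp only [Finset.mem_filter, Finset.mem_univ, true_and] at hu
    rw [SimpleGraph.mem_neighborFinset]
    exact SimpleGraph.edist_eq_one_iff_adj.mp (by simpa using hu)
  | succ r ih =>
    have hsub : (univ.filter fun u => G.edist v u = ((r + 1 + 1 : ℕ) : ℕ∞)) ⊆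
        (univ.filter fun u => G.edist v u = ((r + 1 : ℕ) : ℕ∞)).biUnion
          fun w => (G.neighborFinset w).filter fun u => G.edist v u = ((r + 1 + 1 : ℕ) : ℕ∞) := by
      intro u hu
      simp only [Finset.mem_filter, Finset.mem_univ, true_and] at hu
      obtain ⟨w, hw, hvw⟩ := aux_pred G v u (r + 1) hu
      simp only [Finset.mem_biUnion, Finset.mem_filter, Finset.mem_univ, true_and,
        SimpleGraph.mem_neighborFinset]
      exact ⟨w, hvw, hw, hu⟩
    refine (Finset.card_le_card hsub).trans ?_
    refine (Finset.card_biUnion_le_card_mul _ _ (d - 1) ?_).trans ?_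
    · intro w hw
      simp only [Finset.mem_filter, Finset.mem_univ, true_and] at hw
      obtain ⟨w', hw', hvw'⟩ := aux_pred G v w r hw
      have : ((G.neighborFinset w).filter fun u => G.edist v u = ((r + 1 + 1 : ℕ) : ℕ∞)) ⊆
          (G.neighborFinset w).erase w' := by
        intro u hu
        simp only [Finset.mem_filter] at hu
        rw [Finset.mem_erase]
        refine ⟨?_, hu.1⟩
        rintro rfl
        have := hu.2
        rw [hvw'] at this
        have := ENat.natCast_inj.mp this
        omega
      refine (Finset.card_le_card this).trans ?_
      rw [Finset.card_erase_of_mem (by simpa using hw'.symm),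
        SimpleGraph.card_neighborFinset_eq_degree, hreg]
    · rw [pow_succ, ← mul_assoc]
      exact Nat.mul_le_mul_right _ ih

theorem aux_ball {n d : ℕ} (hd : 3 ≤ d) (G : SimpleGraph (Fin n)) [DecidableRel G.Adj]
    (hreg : ∀ v, G.degree v = d) (v : Fin n) (r : ℕ) :
    (univ.filter fun u => G.edist v u ≤ (r : ℕ∞)).card ≤ 3 * (d - 1) ^ r := by
  induction r with
  | zero =>
    have : (univ.filter fun u => G.edist v u ≤ ((0 : ℕ) : ℕ∞)) = {v} := by
      ext u
      simp only [Finset.mem_filter, Finset.mem_univ, true_and, Nat.cast_zero, nonpos_iff_eq_zero,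
        SimpleGraph.edist_eq_zero_iff, Finset.mem_singleton]
      exact eq_comm
    rw [this]; simp
  | succ r ih =>
    have hsub : (univ.filter fun u => G.edist v u ≤ ((r + 1 : ℕ) : ℕ∞)) ⊆
        (univ.filter fun u => G.edist v u ≤ (r : ℕ∞)) ∪
        (univ.filter fun u => G.edist v u = ((r + 1 : ℕ) : ℕ∞)) := by
      intro u hu
      simp only [Finset.mem_filter, Finset.mem_univ, true_and, Finset.mem_union] at hu ⊢
      rcases hu.lt_or_eq with h | h
      · left
        push_cast at h
        exact Order.le_of_lt_add_one h
      · exact Or.inr h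
    refine (Finset.card_le_card hsub).trans ((Finset.card_union_le _ _).trans ?_)
    have h2 := aux_sphere hd G hreg v r
    obtain ⟨D, rfl⟩ : ∃ D, d = D + 3 := ⟨d - 3, by omega⟩
    have h3 : D + 3 - 1 = D + 2 := by omega
    rw [h3] at h2 ih ⊢
    rw [pow_succ]
    nlinarith [Nat.zero_le (D * (D + 2) ^ r)]

theorem aux_edges {n d : ℕ} (hd : 3 ≤ d) (G : SimpleGraph (Fin n)) [DecidableRel G.Adj]
    (hreg : ∀ v, G.degree v = d) (v : Fin n) (r : ℕ) :
    (G.edgeFinset.filter fun e => edgeDist G v e ≤ (r : ℕ∞)).card ≤ 3 * d * (d - 1) ^ r := by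
  have hsub : (G.edgeFinset.filter fun e => edgeDist G v e ≤ (r : ℕ∞)) ⊆
      (univ.filter fun u => G.edist v u ≤ (r : ℕ∞)).biUnion fun u => G.incidenceFinset u := by
    intro e he
    simp only [Finset.mem_filter, SimpleGraph.mem_edgeFinset] at he
    obtain ⟨h1, h2⟩ := he
    simp only [Finset.mem_biUnion, Finset.mem_filter, Finset.mem_univ, true_and,
      SimpleGraph.mem_incidenceFinset]
    induction e using Sym2.ind with
    | _ a b =>
      simp only [edgeDist, Sym2.lift_mk, min_le_iff] at h2
      rcases h2 with h | h
      · exact ⟨a, h, h1, by simp⟩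
      · exact ⟨b, h, h1, by simp⟩
  refine (Finset.card_le_card hsub).trans ?_
  refine (Finset.card_biUnion_le_card_mul _ _ d ?_).trans ?_
  · intro u _
    rw [SimpleGraph.card_incidenceFinset_eq_degree, hreg]
  · calc _ ≤ 3 * (d - 1) ^ r * d := Nat.mul_le_mul_right _ (aux_ball hd G hreg v r)
      _ = _ := by ring

theorem aux_verts {n d : ℕ} (hd : 3 ≤ d) (G : SimpleGraph (Fin n)) [DecidableRel G.Adj]
    (hreg : ∀ v, G.degree v = d) (e : Sym2 (Fin n)) (r : ℕ) :
    (univ.filter fun v => edgeDist G v e ≤ (r : ℕ∞)).card ≤ 3 * d * (d - 1) ^ r := by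
  induction e using Sym2.ind with
  | _ a b =>
    have hsub : (univ.filter fun v => edgeDist G v s(a, b) ≤ (r : ℕ∞)) ⊆
        (univ.filter fun u => G.edist a u ≤ (r : ℕ∞)) ∪
        (univ.filter fun u => G.edist b u ≤ (r : ℕ∞)) := by
      intro u hu
      simp only [Finset.mem_filter, Finset.mem_univ, true_and, Finset.mem_union, edgeDist,
        Sym2.lift_mk, min_le_iff] at hu ⊢
      rwa [SimpleGraph.edist_comm (u := a), SimpleGraph.edist_comm (u := b)]
    refine (Finset.card_le_card hsub).trans ((Finset.card_union_le _ _).trans ?_)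
    have h1 := aux_ball hd G hreg a r
    have h2 := aux_ball hd G hreg b r
    nlinarith [Nat.zero_le ((d - 1) ^ r)]

theorem aux_comb {V E : Type*} [DecidableEq E] (M : Finset V) (Es F : Finset E) (hF : F ⊆ Es)
    (z : V → E → ℝ) (Q A B : ℝ) (hQ : 0 ≤ Q) (hA : 0 ≤ A)
    (h1 : ∀ v ∈ M, 4 * Q ≤ ∑ e ∈ Es, z v e)
    (h2 : ∀ v ∈ M, ∑ e ∈ Es \ F, z v e ≤ Q)
    (h3 : (F.card : ℝ) * A ≤ M.card)
    (h4 : ∀ e ∈ F, ∑ v ∈ M, z v e ≤ B) :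
    2 * Q * M.card ≤ ((F.filter fun e => A * Q ≤ ∑ v ∈ M, z v e).card : ℝ) * B := by
  have e1 : (M.card : ℝ) * (4 * Q) ≤ ∑ v ∈ M, ∑ e ∈ Es, z v e := by
    rw [← nsmul_eq_mul]; exact Finset.card_nsmul_le_sum _ _ _ h1
  have e2 : ∑ v ∈ M, ∑ e ∈ Es \ F, z v e ≤ M.card * Q := by
    rw [← nsmul_eq_mul]; exact Finset.sum_le_card_nsmul _ _ _ h2
  have e3 : ∑ v ∈ M, ∑ e ∈ Es, z v e =
      ∑ v ∈ M, ∑ e ∈ Es \ F, z v e + ∑ e ∈ F, ∑ v ∈ M, z v e := by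
    rw [Finset.sum_comm (s := F), ← Finset.sum_add_distrib]
    exact Finset.sum_congr rfl fun v _ => (Finset.sum_sdiff hF).symm
  have e4 := Finset.sum_filter_add_sum_filter_not F (fun e => A * Q ≤ ∑ v ∈ M, z v e)
    (fun e => ∑ v ∈ M, z v e)
  have e5 : ∑ e ∈ F.filter (fun e => A * Q ≤ ∑ v ∈ M, z v e), ∑ v ∈ M, z v e ≤
      ((F.filter fun e => A * Q ≤ ∑ v ∈ M, z v e).card : ℝ) * B := by
    rw [← nsmul_eq_mul]
    exact Finset.sum_le_card_nsmul _ _ _ fun e he => h4 e (Finset.mem_filter.mp he).1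
  have e6 : ∑ e ∈ F.filter (fun e => ¬ A * Q ≤ ∑ v ∈ M, z v e), ∑ v ∈ M, z v e ≤
      M.card * Q := by
    calc _ ≤ (F.filter fun e => ¬ A * Q ≤ ∑ v ∈ M, z v e).card • (A * Q) :=
          Finset.sum_le_card_nsmul _ _ _ fun e he => (not_le.mp (Finset.mem_filter.mp he).2).le
      _ ≤ (F.card : ℝ) * (A * Q) := by
          rw [nsmul_eq_mul]
          apply mul_le_mul_of_nonneg_right _ (by positivity)
          exact_mod_cast Finset.card_le_card (Finset.filter_subset _ _)
      _ ≤ _ := by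
          rw [← mul_assoc]; exact mul_le_mul_of_nonneg_right h3 hQ
  linarith

theorem aux_root {q C D De t x Lt : ℝ} {ℓ : ℕ} (hq : 2 ≤ q) (hC : 1 ≤ C) (hD : 0 < D)
    (hDe : 0 < De) (ht : 0 ≤ t) (hx : 0 ≤ x) (hLt : 0 < Lt)
    (h : D ^ ℓ * t ^ q ≤ 4 * Lt * De ^ ℓ * (2 * C * x) ^ q) :
    (D / De) ^ ((ℓ : ℝ) / q) * t ≤ 4 * C * Lt ^ (1 / q) * x := by
  have hq0 : 0 < q := by linarith
  have hC0 : 0 < C := by linarith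
  have hr : 0 < D / De := by positivity
  have hL1 : 0 ≤ Lt ^ (1 / q) := (Real.rpow_pos_of_pos hLt _).le
  rw [← Real.rpow_le_rpow_iff (z := q) (by positivity) (by positivity) hq0]
  rw [show 4 * C * Lt ^ (1 / q) * x = (2 * Lt ^ (1 / q)) * (2 * C * x) by ring]
  rw [Real.mul_rpow (by positivity) ht, Real.mul_rpow (by positivity) (by positivity),
    Real.mul_rpow (by norm_num) hL1, ← Real.rpow_mul hr.le, ← Real.rpow_mul hLt.le,
    div_mul_cancel₀ _ hq0.ne', div_mul_cancel₀ _ hq0.ne', Real.rpow_one, Real.rpow_natCast]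
  have h4 : (4 : ℝ) ≤ 2 ^ q := by
    calc (4 : ℝ) = 2 ^ (2 : ℝ) := by norm_num
      _ ≤ 2 ^ q := Real.rpow_le_rpow_of_exponent_le (by norm_num) hq
  have hX : 0 ≤ (2 * C * x) ^ q := by positivity
  rw [div_pow, div_mul_eq_mul_div, div_le_iff₀ (by positivity)]
  calc D ^ ℓ * t ^ q ≤ 4 * Lt * De ^ ℓ * (2 * C * x) ^ q := h
    _ = 4 * (Lt * De ^ ℓ * (2 * C * x) ^ q) := by ring
    _ ≤ 2 ^ q * (Lt * De ^ ℓ * (2 * C * x) ^ q) := by gcongr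
    _ = _ := by ring

set_option maxHeartbeats 2000000 in
/-- Lemma 3.10: the dichotomy for the sets `M(b, ℓ)`. -/
theorem stmt_12 {n d k : ℕ} (q C α ε L : ℝ)
    (hq : 2 ≤ q) (hC : 1 ≤ C) (hd : 3 ≤ d)
    (hα : 0 < α ∧ α ≤ 1) (hε : 0 < ε ∧ ε ≤ 1) (hL : 1 ≤ L)
    (G : SimpleGraph (Fin n)) [DecidableRel G.Adj]
    (hreg : ∀ v, G.degree v = d)
    (hExp : Expan n d G α ε L)
    (hk : 1 ≤ k) (N : (Fin k → ℝ) → ℝ)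
    (hN : IsNorm k N) (hunc : OneUnconditional k N)
    (f : Fin n → Fin k → ℝ)
    (hval : ∀ v j, f v j = -1 ∨ f v j = 0 ∨ f v j = 1)
    (hmed : ∀ j, (n : ℝ) / 2 ≤
      min ((univ.filter fun v => 0 ≤ f v j).card : ℝ)
        ((univ.filter fun v => f v j ≤ 0).card : ℝ))
    (hrc : RestrictedCotype k N q C
      {y | ∃ (v : Fin n) (J : Finset (Fin k)), y = proj J fun j => |f v j|})
    (Et : Fin n → Fin k → Finset (Sym2 (Fin n)))
    (hEt : ∀ v j, f v j ≠ 0 →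
      Et v j ⊆ jumpEdges G f j {v} (lvj G f α d v j) ∧
        α * aseq (lvj G f α d v j) / 12 * ((d : ℝ) - 1) ^ (lvj G f α d v j - 1) ≤
          ((Et v j).card : ℝ))
    (hEt2 : ∀ (j : Fin k) (ℓ : ℕ), 1 ≤ ℓ → ∀ e ∈ G.edgeFinset,
      ((univ.filter fun v => j ∈ JsetE G f α d Et v ℓ e).card : ℝ) ≤
        2 * (2 * (20 * (d : ℝ) * L / (α * ε)) ^ 8) * ((d : ℝ) - 1 - ε) ^ ℓ)
    (b : ℤ) (ℓ : ℕ) (hℓ : 1 ≤ ℓ) :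
    ((univ.filter fun v =>
          (2 : ℝ) ^ b ≤ N (proj (Jset G f α d v ℓ) (f v))).card : ℝ) / aseq ℓ ^ 2 ≤
        ((G.edgeFinset.filter fun e =>
            α ^ 3 / (2 ^ 15 * (d : ℝ) ^ 3 * C *
                  (2 * (20 * (d : ℝ) * L / (α * ε)) ^ 8) ^ (1 / q)) *
                aseq ℓ * (2 : ℝ) ^ b ≤ edgeNorm N f e).card : ℝ) ∨
      α ^ 3 / (2 ^ 15 * (d : ℝ) ^ 3 * C *
            (2 * (20 * (d : ℝ) * L / (α * ε)) ^ 8) ^ (1 / q)) * aseq ℓ *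
          ((univ.filter fun v =>
            (2 : ℝ) ^ b ≤ N (proj (Jset G f α d v ℓ) (f v))).card : ℝ) ≤
        ((G.edgeFinset.filter fun e =>
            α ^ 3 / (2 ^ 15 * (d : ℝ) ^ 3 * C *
                  (2 * (20 * (d : ℝ) * L / (α * ε)) ^ 8) ^ (1 / q)) *
                aseq ℓ ^ 3 * (2 : ℝ) ^ b *
                (((d : ℝ) - 1) / ((d : ℝ) - 1 - ε)) ^ ((ℓ : ℝ) / q) ≤
              edgeNorm N f e).card : ℝ) := by
  obtain ⟨hα0, hα1⟩ := hα
  obtain ⟨hε0, hε1⟩ := hε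
  have hd3 : (3 : ℝ) ≤ d := by exact_mod_cast hd
  set Lt : ℝ := 2 * (20 * (d : ℝ) * L / (α * ε)) ^ 8 with hLt
  have hLt1 : 1 ≤ Lt := by
    have : 1 ≤ 20 * (d : ℝ) * L / (α * ε) := by
      rw [le_div_iff₀ (by positivity)]
      have h1 : α * ε ≤ 1 := mul_le_one₀ hα1 hε0.le hε1
      nlinarith
    have := one_le_pow₀ this (n := 8)
    rw [hLt]; linarith
  have hLt0 : 0 < Lt := by linarith
  have hq0 : 0 < q := by linarith
  set W : ℝ := Lt ^ (1 / q) with hW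
  have hW1 : 1 ≤ W := Real.one_le_rpow hLt1 (by positivity)
  have hW0 : 0 < W := by linarith
  have hC0 : 0 < C := by linarith
  have hd0 : (0 : ℝ) < d := by linarith
  set ch : ℝ := α ^ 3 / (2 ^ 15 * (d : ℝ) ^ 3 * C * W) with hch
  have hch0 : 0 < ch := by positivity
  have hchb : ch * (144 * d) ≤ α := by
    rw [hch, div_mul_eq_mul_div, div_le_iff₀ (by positivity)]
    have h1 : α ^ 3 ≤ α := by nlinarith [mul_pos hα0 hα0]
    have h2 : (d : ℝ) ≤ (d : ℝ) ^ 3 := le_self_pow₀ (by linarith) (by norm_num)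
    have h3 : 1 ≤ C * W := by nlinarith
    have h4 : (d : ℝ) ≤ (d : ℝ) ^ 3 * (C * W) := by
      nlinarith [mul_nonneg (pow_nonneg hd0.le 3) (sub_nonneg.mpr h3)]
    calc α ^ 3 * (144 * d) ≤ α * (144 * d) := by gcongr
      _ ≤ α * (2 ^ 15 * ((d : ℝ) ^ 3 * (C * W))) := by
          apply mul_le_mul_of_nonneg_left _ hα0.le
          nlinarith
      _ = _ := by ring
  set a : ℝ := aseq ℓ with ha
  have ha0 : 0 < a := by
    rw [ha, aseq]
    have : (0 : ℝ) < ℓ := by exact_mod_cast hℓ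
    positivity
  set B : ℝ := (2 : ℝ) ^ b with hB
  have hB0 : 0 < B := by positivity
  set D : ℝ := (d : ℝ) - 1 with hD
  have hD2 : 2 ≤ D := by rw [hD]; linarith
  have hD0 : 0 < D := by linarith
  have hDe : 0 < D - ε := by linarith
  have hDe1 : 1 ≤ D - ε := by linarith
  have hDcast : (((d - 1 : ℕ) : ℕ) : ℝ) = D := by
    rw [hD, Nat.cast_sub (by omega)]; simp
  set M := univ.filter fun v => B ≤ N (proj (Jset G f α d v ℓ) (f v)) with hM
  set F := G.edgeFinset.filter fun e => ch * a * B ≤ edgeNorm N f e with hF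
  by_cases hi : (M.card : ℝ) / a ^ 2 ≤ F.card
  · exact Or.inl hi
  right
  push Not at hi
  have hf1 : ∀ v j, |f v j| ≤ 1 := by
    intro v j
    rcases hval v j with h | h | h <;> simp [h]
  -- the vectors
  set Y : Fin n → Sym2 (Fin n) → ℝ :=
    fun v e => N (proj (JsetE G f α d Et v ℓ e) fun j => |f v j|) with hY
  set X : Fin n → ℝ := fun v => N (proj (Jset G f α d v ℓ) (f v)) with hX
  have hY0 : ∀ v e, 0 ≤ Y v e := fun v e => aux_nonneg hN hunc _
  have hX0 : ∀ v, 0 ≤ X v := fun v => aux_nonneg hN hunc _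
  have hXM : ∀ v ∈ M, B ≤ X v := fun v hv => (Finset.mem_filter.mp hv).2
  have hmemE : ∀ v e j, j ∈ JsetE G f α d Et v ℓ e →
      e ∈ jumpEdges G f j {v} ℓ := by
    intro v e j hj
    simp only [JsetE, Jset, Finset.mem_filter, Finset.mem_univ, true_and] at hj
    have := (hEt v j hj.1.1).1 hj.2
    rwa [hj.1.2] at this
  have hnear : ∀ v e j, j ∈ JsetE G f α d Et v ℓ e →
      edgeDist G v e ≤ ((ℓ - 1 : ℕ) : ℕ∞) := by
    intro v e j hj
    have := hmemE v e j hj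
    simp only [jumpEdges, Finset.mem_filter, edgeSetDist, Finset.inf_singleton] at this
    exact this.2.1
  have hedge : ∀ e (z : Fin k → ℝ), (∀ j, |z j| ≤ 1) →
      (∀ j, z j ≠ 0 → ∃ v, j ∈ JsetE G f α d Et v ℓ e) → N z ≤ edgeNorm N f e := by
    intro e z hz1 hz2
    have hz3 : ∀ j, z j ≠ 0 →
        Sym2.lift ⟨fun a b => f a j ≠ f b j, fun _ _ => propext ne_comm⟩ e := by
      intro j hj
      obtain ⟨v, hv⟩ := hz2 j hj
      have := hmemE v e j hv
      simp only [jumpEdges, Finset.mem_filter] at this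
      exact this.2.2
    induction e using Sym2.ind with
    | _ u w =>
      simp only [Sym2.lift_mk] at hz3
      have key : ∀ j, |z j| ≤ |f u j - f w j| := by
        intro j
        by_cases h : z j = 0
        · rw [h]; simp
        · have hne := hz3 j h
          refine (hz1 j).trans ?_
          rcases hval u j with h1 | h1 | h1 <;> rcases hval w j with h2 | h2 | h2 <;>
            rw [h1, h2] at hne ⊢ <;> first | exact absurd rfl hne | norm_num
      simp only [edgeNorm, Sym2.lift_mk, le_min_iff]
      refine ⟨aux_mono hN hunc _ _ key, aux_mono hN hunc _ _ ?_⟩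
      intro j
      rw [Pi.sub_apply, abs_sub_comm]
      exact key j
  have hYx : ∀ v e, Y v e ≤ edgeNorm N f e := by
    intro v e
    apply hedge
    · intro j
      simp only [proj]
      split_ifs
      · rw [abs_abs]; exact hf1 v j
      · simp
    · intro j hj
      refine ⟨v, ?_⟩
      by_contra hh
      exact hj (by simp [proj, hh])
  have hYX : ∀ v e, Y v e ≤ X v := by
    intro v e
    apply aux_mono hN hunc
    intro j
    simp only [proj]
    by_cases hj : j ∈ JsetE G f α d Et v ℓ e
    · have : j ∈ Jset G f α d v ℓ := (Finset.mem_filter.mp hj).1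
      simp [hj, this]
    · simp [hj]
  have hYfar : ∀ v e, Y v e ≠ 0 → edgeDist G v e ≤ ((ℓ - 1 : ℕ) : ℕ∞) := by
    intro v e h
    by_contra hh
    apply h
    rw [hY]
    simp only
    rw [hN.1]
    funext j
    have : j ∉ JsetE G f α d Et v ℓ e := fun hj => hh (hnear v e j hj)
    simp [proj, this]
  set κ : ℝ := α * a / 12 * D ^ (ℓ - 1) with hκ
  have hκ0 : 0 < κ := by positivity
  have hYsum : ∀ v, κ * X v ≤ ∑ e ∈ G.edgeFinset, Y v e := by
    intro v
    refine le_trans ?_ (aux_sum hN G.edgeFinset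
      (fun e => proj (JsetE G f α d Et v ℓ e) fun j => |f v j|))
    rw [show κ * X v = N (κ • proj (Jset G f α d v ℓ) (f v)) by
      rw [hN.2.1, abs_of_pos hκ0]]
    apply aux_mono hN hunc
    intro j
    simp only [Pi.smul_apply, Finset.sum_apply, smul_eq_mul]
    by_cases hj : j ∈ Jset G f α d v ℓ
    swap
    · simp [proj, hj]
    have hj' := hj
    simp only [Jset, Finset.mem_filter, Finset.mem_univ, true_and] at hj'
    obtain ⟨hs, hc⟩ := hEt v j hj'.1
    rw [hj'.2] at hs hc
    have hsum : ∑ e ∈ G.edgeFinset, proj (JsetE G f α d Et v ℓ e) (fun j => |f v j|) j =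
        ((Et v j).card : ℝ) * |f v j| := by
      have h1 : ∀ e, proj (JsetE G f α d Et v ℓ e) (fun j => |f v j|) j =
          if e ∈ Et v j then |f v j| else 0 := by
        intro e
        simp only [proj, JsetE, Finset.mem_filter, hj, true_and]
      simp only [h1]
      rw [← Finset.sum_filter, Finset.sum_const, nsmul_eq_mul]
      congr 3
      ext e
      simp only [Finset.mem_filter]
      refine ⟨fun h => h.2, fun h => ⟨?_, h⟩⟩
      exact (Finset.mem_filter.mp (hs h)).1
    rw [hsum]
    simp only [proj, hj, if_true]
    rw [abs_mul κ, abs_mul _ |f v j|, abs_abs, abs_of_pos hκ0, Nat.abs_cast]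
    exact mul_le_mul_of_nonneg_right hc (abs_nonneg _)
  set z : Fin n → Sym2 (Fin n) → ℝ := fun v e => Y v e * (B / X v) with hz
  have hz0 : ∀ v e, 0 ≤ z v e := fun v e =>
    mul_nonneg (hY0 v e) (div_nonneg hB0.le (hX0 v))
  have hzY : ∀ v ∈ M, ∀ e, z v e ≤ Y v e := by
    intro v hv e
    exact mul_le_of_le_one_right (hY0 v e) (div_le_one_of_le₀ (hXM v hv) (hX0 v))
  have hzB : ∀ v ∈ M, ∀ e, z v e ≤ B := by
    intro v hv e
    have hXp : 0 < X v := hB0.trans_le (hXM v hv)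
    calc z v e ≤ X v * (B / X v) :=
          mul_le_mul_of_nonneg_right (hYX v e) (by positivity)
      _ = B := by field_simp
  have hzfar : ∀ v e, z v e ≠ 0 → edgeDist G v e ≤ ((ℓ - 1 : ℕ) : ℕ∞) := by
    intro v e h
    exact hYfar v e (left_ne_zero_of_mul h)
  set P : ℝ := 3 * d * D ^ (ℓ - 1) with hP
  have hP0 : 0 < P := by positivity
  have hPv : ∀ e, (((univ : Finset (Fin n)).filter fun v => edgeDist G v e ≤ ((ℓ - 1 : ℕ) : ℕ∞)).card : ℝ) ≤ P := by
    intro e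
    have := aux_verts hd G hreg e (ℓ - 1)
    rw [hP, ← hDcast]
    exact_mod_cast this
  have hPe : ∀ v, ((G.edgeFinset.filter fun e => edgeDist G v e ≤ ((ℓ - 1 : ℕ) : ℕ∞)).card : ℝ) ≤ P := by
    intro v
    have := aux_edges hd G hreg v (ℓ - 1)
    rw [hP, ← hDcast]
    exact_mod_cast this
  set Q : ℝ := α * a / 48 * D ^ (ℓ - 1) * B with hQ
  have hQ0 : 0 < Q := by positivity
  have hcomb := aux_comb M G.edgeFinset F (Finset.filter_subset _ _) z Q (a ^ 2) (P * B) hQ0.le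
    (by positivity) ?_ ?_ ?_ ?_
  rotate_left
  · intro v hv
    have hXp : 0 < X v := hB0.trans_le (hXM v hv)
    simp only [hz]
    rw [← Finset.sum_mul]
    calc 4 * Q = κ * X v * (B / X v) := by rw [hQ, hκ]; field_simp; ring
      _ ≤ _ := mul_le_mul_of_nonneg_right (hYsum v) (by positivity)
  · intro v hv
    calc ∑ e ∈ G.edgeFinset \ F, z v e
        = ∑ e ∈ (G.edgeFinset \ F).filter (fun e => z v e ≠ 0), z v e :=
          (Finset.sum_filter_ne_zero _).symm
      _ ≤ ((G.edgeFinset \ F).filter (fun e => z v e ≠ 0)).card • (ch * a * B) := by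
          apply Finset.sum_le_card_nsmul
          intro e he
          simp only [Finset.mem_filter, Finset.mem_sdiff, hF, not_and, not_le] at he
          exact ((hzY v hv e).trans (hYx v e)).trans (he.1.2 he.1.1).le
      _ ≤ P * (ch * a * B) := by
          rw [nsmul_eq_mul]
          apply mul_le_mul_of_nonneg_right _ (by positivity)
          refine le_trans ?_ (hPe v)
          have : ((G.edgeFinset \ F).filter (fun e => z v e ≠ 0)) ⊆
              G.edgeFinset.filter fun e => edgeDist G v e ≤ ((ℓ - 1 : ℕ) : ℕ∞) := by
            intro e he
            rw [Finset.mem_filter] at he ⊢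
            exact ⟨(Finset.mem_sdiff.mp he.1).1, hzfar v e he.2⟩
          exact_mod_cast Finset.card_le_card this
      _ = (ch * (144 * d)) * (a / 48 * D ^ (ℓ - 1) * B) := by rw [hP]; ring
      _ ≤ α * (a / 48 * D ^ (ℓ - 1) * B) := mul_le_mul_of_nonneg_right hchb (by positivity)
      _ = Q := by rw [hQ]; ring
  · rw [lt_div_iff₀ (by positivity)] at hi
    exact hi.le
  · intro e _
    calc ∑ v ∈ M, z v e = ∑ v ∈ M.filter (fun v => z v e ≠ 0), z v e :=
          (Finset.sum_filter_ne_zero _).symm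
      _ ≤ (M.filter (fun v => z v e ≠ 0)).card • B := by
          apply Finset.sum_le_card_nsmul
          intro v hv
          exact hzB v (Finset.mem_filter.mp hv).1 e
      _ ≤ P * B := by
          rw [nsmul_eq_mul]
          apply mul_le_mul_of_nonneg_right _ hB0.le
          refine le_trans ?_ (hPv e)
          have : (M.filter (fun v => z v e ≠ 0)) ⊆
              univ.filter fun v => edgeDist G v e ≤ ((ℓ - 1 : ℕ) : ℕ∞) := by
            intro v hv
            rw [Finset.mem_filter] at hv ⊢
            exact ⟨Finset.mem_univ _, hzfar v e hv.2⟩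
          exact_mod_cast Finset.card_le_card this
  set Gd := F.filter fun e => a ^ 2 * Q ≤ ∑ v ∈ M, z v e with hGd
  have hGcard : ch * a * M.card ≤ (Gd.card : ℝ) := by
    have h1 : (2 * Q * M.card : ℝ) = (P * B) * (α * a / (72 * d) * M.card) := by
      rw [hQ, hP]; field_simp; ring
    rw [h1, mul_comm (Gd.card : ℝ)] at hcomb
    have h2 := le_of_mul_le_mul_left hcomb (by positivity)
    refine le_trans ?_ h2
    apply mul_le_mul_of_nonneg_right _ (Nat.cast_nonneg _)
    rw [le_div_iff₀ (by positivity)]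
    have h3 := mul_le_mul_of_nonneg_right hchb ha0.le
    have h4 := mul_pos (mul_pos hch0 ha0) hd0
    linarith [show ch * (144 * d) * a = 144 * (ch * a * d) by ring,
      show ch * a * (72 * d) = 72 * (ch * a * d) by ring]
  refine hGcard.trans ?_
  have hfin : Gd ⊆ G.edgeFinset.filter fun e =>
      ch * a ^ 3 * B * (D / (D - ε)) ^ ((ℓ : ℝ) / q) ≤ edgeNorm N f e := by
    intro e he
    obtain ⟨heF, heS⟩ := Finset.mem_filter.mp he
    obtain ⟨heG, heN⟩ := Finset.mem_filter.mp heF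
    refine Finset.mem_filter.mpr ⟨heG, ?_⟩
    set x := edgeNorm N f e with hx
    have hx0 : 0 ≤ x := le_trans (by positivity) heN
    set R : ℝ := 2 * Lt * (D - ε) ^ ℓ with hR
    have hR1 : 1 ≤ R := by
      have := one_le_pow₀ hDe1 (n := ℓ)
      rw [hR]
      exact one_le_mul_of_one_le_of_one_le (by linarith) this
    have hcore := aux_core hq hC hN hunc f hf1 hrc (fun v => JsetE G f α d Et v ℓ e)
      (hedge e) ⌊R⌋₊ (Nat.le_floor (by simpa using hR1))
      (fun j => Nat.le_floor (hEt2 j ℓ hℓ e heG))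
    have hfl : (⌊R⌋₊ : ℝ) ≤ R := Nat.floor_le (by linarith)
    have hq1 : ∑ v, (Y v e / 2) ^ q ≤ 2 * R * (C ^ q * x ^ q) := by
      refine hcore.trans ?_
      gcongr
    -- power mean
    have hMe : ((M.filter (fun v => z v e ≠ 0)).card : ℝ) ≤ P := by
      refine le_trans ?_ (hPv e)
      have : (M.filter (fun v => z v e ≠ 0)) ⊆
          univ.filter fun v => edgeDist G v e ≤ ((ℓ - 1 : ℕ) : ℕ∞) := by
        intro v hv
        rw [Finset.mem_filter] at hv ⊢
        exact ⟨Finset.mem_univ _, hzfar v e hv.2⟩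
      exact_mod_cast Finset.card_le_card this
    rw [← Finset.sum_filter_ne_zero] at heS
    have hpm := Real.rpow_sum_le_const_mul_sum_rpow_of_nonneg (M.filter (fun v => z v e ≠ 0))
      (f := fun v => z v e) (p := q) (by linarith) (fun v _ => hz0 v e)
    have hzs : ∑ v ∈ M.filter (fun v => z v e ≠ 0), z v e ^ q ≤ 2 * R * (2 * C * x) ^ q := by
      calc ∑ v ∈ M.filter (fun v => z v e ≠ 0), z v e ^ q
          ≤ ∑ v ∈ M.filter (fun v => z v e ≠ 0), Y v e ^ q := by
            apply Finset.sum_le_sum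
            intro v hv
            exact Real.rpow_le_rpow (hz0 v e) (hzY v (Finset.mem_filter.mp hv).1 e) hq0.le
        _ ≤ ∑ v, Y v e ^ q := by
            apply Finset.sum_le_sum_of_subset_of_nonneg (Finset.subset_univ _)
            intro v _ _
            exact Real.rpow_nonneg (hY0 v e) _
        _ = 2 ^ q * ∑ v, (Y v e / 2) ^ q := by
            rw [Finset.mul_sum]
            apply Finset.sum_congr rfl
            intro v _
            rw [← Real.mul_rpow (by norm_num) (div_nonneg (hY0 v e) (by norm_num))]
            congr 1; ring
        _ ≤ 2 ^ q * (2 * R * (C ^ q * x ^ q)) := by gcongr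
        _ = 2 * R * (2 * C * x) ^ q := by
            rw [Real.mul_rpow (by positivity) hx0, Real.mul_rpow (by norm_num) hC0.le]; ring
    set t : ℝ := α * a ^ 3 / (144 * d) * B with ht
    have ht0 : 0 < t := by positivity
    have htQ : a ^ 2 * Q = P * t := by
      rw [hQ, hP, ht]; field_simp; ring
    have hmain : (P * t) ^ q ≤ P ^ (q - 1) * (2 * R * (2 * C * x) ^ q) := by
      rw [← htQ]
      refine (Real.rpow_le_rpow (by positivity) heS hq0.le).trans (hpm.trans ?_)
      have h1 : ((M.filter (fun v => z v e ≠ 0)).card : ℝ) ^ (q - 1) ≤ P ^ (q - 1) :=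
        Real.rpow_le_rpow (Nat.cast_nonneg _) hMe (by linarith)
      exact mul_le_mul h1 hzs (Finset.sum_nonneg fun v _ => Real.rpow_nonneg (hz0 v e) _)
        (by positivity)
    rw [Real.mul_rpow hP0.le ht0.le] at hmain
    have h6 : P ^ q = P ^ (q - 1) * P := by
      rw [← Real.rpow_add_one hP0.ne']; congr 1; ring
    rw [h6, mul_assoc] at hmain
    have hmain2 := le_of_mul_le_mul_left hmain (Real.rpow_pos_of_pos hP0 _)
    have hPD : D ^ ℓ ≤ P := by
      obtain ⟨r, rfl⟩ : ∃ r, ℓ = r + 1 := ⟨ℓ - 1, by omega⟩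
      rw [hP, pow_succ, Nat.add_sub_cancel, mul_comm]
      apply mul_le_mul_of_nonneg_right _ (by positivity)
      rw [hD]; linarith
    have hroot := aux_root (ℓ := ℓ) hq hC hD0 hDe ht0.le hx0 hLt0 (by
      calc D ^ ℓ * t ^ q ≤ P * t ^ q := by gcongr
        _ ≤ 2 * R * (2 * C * x) ^ q := hmain2
        _ = _ := by rw [hR]; ring)
    rw [← hW] at hroot
    set ρ : ℝ := (D / (D - ε)) ^ ((ℓ : ℝ) / q) with hρ
    have hw0 : 0 ≤ 144 * α ^ 2 / (2 ^ 15 * (d : ℝ) ^ 2 * C * W) := by positivity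
    calc ch * a ^ 3 * B * ρ = (ρ * t) * (144 * α ^ 2 / (2 ^ 15 * (d : ℝ) ^ 2 * C * W)) := by
          rw [hch, ht]; field_simp
      _ ≤ (4 * C * W * x) * (144 * α ^ 2 / (2 ^ 15 * (d : ℝ) ^ 2 * C * W)) :=
          mul_le_mul_of_nonneg_right hroot hw0
      _ = (576 * α ^ 2 / (2 ^ 15 * (d : ℝ) ^ 2)) * x := by field_simp; ring
      _ ≤ x := by
          apply mul_le_of_le_one_left hx0
          apply div_le_one_of_le₀ _ (by positivity)
          have h1 : α ^ 2 ≤ 1 := pow_le_one₀ hα0.le hα1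
          have h2 : 1 ≤ (d : ℝ) ^ 2 := one_le_pow₀ (by linarith)
          clear_value x ρ t
          linarith
  exact_mod_cast Finset.card_le_card hfin
end

section
/- Let d ≥ 3 be an integer, let G be a d-regular simple graph on [n], let S ⊆ [n] be nonempty, let ℓ ≥ 1 be an integer, let ε ∈ (0,1] and L > 0, and set T := {e ∈ E_G : |{v ∈ S : dist_G(v,e) ≤ ℓ−1}| ≥ L(d−1−ε)^ℓ}. Then |T| ≤ |S| · (d/(L(d−2))) · ((d−1)/(d−1−ε))^ℓ. -/
open Finset

attribute [local instance] Classical.propDecidable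

lemma edgeDist_mk {n : ℕ} (G : SimpleGraph (Fin n)) (v a b : Fin n) :
    edgeDist G v s(a, b) = min (G.edist v a) (G.edist v b) := rfl

lemma edgeDist_le_of_mem {n : ℕ} (G : SimpleGraph (Fin n)) (v a : Fin n) (e : Sym2 (Fin n))
    (h : a ∈ e) : edgeDist G v e ≤ G.edist v a := by
  induction e using Sym2.ind with
  | _ x y =>
    rw [edgeDist_mk]
    rcases Sym2.mem_iff.1 h with rfl | rfl
    · exact min_le_left _ _
    · exact min_le_right _ _

lemma exists_mem_edgeDist {n : ℕ} (G : SimpleGraph (Fin n)) (v : Fin n) (e : Sym2 (Fin n)) :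
    ∃ a b, e = s(a, b) ∧ G.edist v a = edgeDist G v e := by
  induction e using Sym2.ind with
  | _ x y =>
    rw [edgeDist_mk]
    rcases le_total (G.edist v x) (G.edist v y) with h | h
    · exact ⟨x, y, rfl, (min_eq_left h).symm⟩
    · exact ⟨y, x, Sym2.eq_swap, (min_eq_right h).symm⟩

lemma exists_pred {n : ℕ} (G : SimpleGraph (Fin n)) (v x : Fin n) (k : ℕ)
    (h : G.edist v x = ((k + 1 : ℕ) : ℕ∞)) :
    ∃ y, G.Adj y x ∧ edgeDist G v s(y, x) = (k : ℕ∞) := by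
  rw [SimpleGraph.edist_comm] at h
  obtain ⟨p, hp⟩ := SimpleGraph.exists_walk_of_edist_eq_coe h
  cases p with
  | nil => simp at hp
  | @cons _ y _ hadj q =>
    have hq : q.length = k := by simpa using hp
    refine ⟨y, hadj.symm, ?_⟩
    have h1 : G.edist v y ≤ k := by
      rw [SimpleGraph.edist_comm, ← hq]; exact SimpleGraph.edist_le q
    have h2 : G.edist x v ≤ G.edist x y + G.edist y v := SimpleGraph.edist_triangle
    rw [SimpleGraph.edist_eq_one_iff_adj.2 hadj, h, SimpleGraph.edist_comm (u := y)] at h2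
    have h3 : (k : ℕ∞) ≤ G.edist v y := by
      generalize G.edist v y = z at *
      cases z with
      | top => exact le_top
      | coe z => norm_cast at *; omega
    rw [edgeDist_mk, le_antisymm h1 h3, SimpleGraph.edist_comm (u := v), h]
    apply min_eq_left
    norm_cast; omega

lemma card_edgeSphere {n d : ℕ} (G : SimpleGraph (Fin n)) [DecidableRel G.Adj]
    (hreg : ∀ v, G.degree v = d) (v : Fin n) (k : ℕ) :
    (G.edgeFinset.filter fun e => edgeDist G v e = (k : ℕ∞)).card ≤ d * (d - 1) ^ k := by
  induction k with
  | zero =>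
    rw [pow_zero, mul_one, ← hreg v, ← SimpleGraph.card_incidenceFinset_eq_degree]
    apply card_le_card
    intro e he
    simp only [mem_filter, SimpleGraph.mem_edgeFinset] at he
    obtain ⟨a, b, rfl, hab⟩ := exists_mem_edgeDist G v e
    rw [he.2] at hab
    have : v = a := by simpa using hab
    subst this
    rw [SimpleGraph.mem_incidenceFinset]
    exact ⟨he.1, by simp⟩
  | succ k ih =>
    have hsub : (G.edgeFinset.filter fun e => edgeDist G v e = ((k + 1 : ℕ) : ℕ∞)) ⊆
        (G.edgeFinset.filter fun e => edgeDist G v e = (k : ℕ∞)).biUnion fun e =>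
          G.edgeFinset.filter fun e' => edgeDist G v e' = ((k + 1 : ℕ) : ℕ∞) ∧
            ∃ x, x ∈ e ∧ x ∈ e' := by
      intro e he
      simp only [mem_filter, SimpleGraph.mem_edgeFinset] at he
      obtain ⟨a, b, rfl, hab⟩ := exists_mem_edgeDist G v e
      rw [he.2] at hab
      obtain ⟨y, hy, hyd⟩ := exists_pred G v a k hab
      simp only [mem_biUnion, mem_filter, SimpleGraph.mem_edgeFinset]
      exact ⟨s(y, a), ⟨hy, hyd⟩, he.1, he.2, a, by simp, by simp⟩
    refine (card_le_card hsub).trans ?_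
    refine (card_biUnion_le_card_mul _ _ (d - 1) ?_).trans ?_
    · intro e he
      simp only [mem_filter, SimpleGraph.mem_edgeFinset] at he
      obtain ⟨a, b, rfl, hab⟩ := exists_mem_edgeDist G v e
      rw [he.2] at hab
      have hmem : s(a, b) ∈ G.incidenceFinset b := by
        rw [SimpleGraph.mem_incidenceFinset]; exact ⟨he.1, by simp⟩
      rw [← hreg b, ← SimpleGraph.card_incidenceFinset_eq_degree, ← card_erase_of_mem hmem]
      apply card_le_card
      intro e' he'
      simp only [mem_filter, SimpleGraph.mem_edgeFinset] at he'
      obtain ⟨h1, h2, x, hx, hx'⟩ := he'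
      rw [mem_erase, SimpleGraph.mem_incidenceFinset]
      refine ⟨?_, h1, ?_⟩
      · rintro rfl
        rw [he.2] at h2
        norm_cast at h2; omega
      · rcases Sym2.mem_iff.1 hx with rfl | rfl
        · have := edgeDist_le_of_mem G v _ _ hx'
          rw [h2, hab] at this
          norm_cast at this; omega
        · exact hx'
    · rw [pow_succ, ← mul_assoc]
      exact Nat.mul_le_mul_right _ ih

lemma card_edgeBall {n d : ℕ} (hd : 3 ≤ d) (G : SimpleGraph (Fin n)) [DecidableRel G.Adj]
    (hreg : ∀ v, G.degree v = d) (v : Fin n) (ℓ : ℕ) (hℓ : 1 ≤ ℓ) :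
    ((G.edgeFinset.filter fun e => edgeDist G v e ≤ ((ℓ - 1 : ℕ) : ℕ∞)).card : ℝ) ≤
      (d : ℝ) / ((d : ℝ) - 2) * ((d : ℝ) - 1) ^ ℓ := by
  have hd' : (3 : ℝ) ≤ d := by exact_mod_cast hd
  have h1 : (G.edgeFinset.filter fun e => edgeDist G v e ≤ ((ℓ - 1 : ℕ) : ℕ∞)).card ≤
      ∑ k ∈ range ℓ, d * (d - 1) ^ k := by
    have hsub : (G.edgeFinset.filter fun e => edgeDist G v e ≤ ((ℓ - 1 : ℕ) : ℕ∞)) ⊆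
        (range ℓ).biUnion fun k => G.edgeFinset.filter fun e => edgeDist G v e = (k : ℕ∞) := by
      intro e he
      simp only [mem_filter, mem_biUnion, mem_range] at he ⊢
      obtain ⟨k, hk, hk'⟩ := ENat.le_coe_iff.1 he.2
      exact ⟨k, by omega, he.1, hk⟩
    exact (card_le_card hsub).trans
      (card_biUnion_le.trans (sum_le_sum fun k _ => card_edgeSphere G hreg v k))
  have h2 : ((∑ k ∈ range ℓ, d * (d - 1) ^ k : ℕ) : ℝ) =
      d * ((((d : ℝ) - 1) ^ ℓ - 1) / ((d : ℝ) - 1 - 1)) := by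
    rw [← geom_sum_eq (by linarith), mul_sum]
    push_cast [Nat.cast_sub (show 1 ≤ d by omega)]
    rfl
  have h3 : ((G.edgeFinset.filter fun e => edgeDist G v e ≤ ((ℓ - 1 : ℕ) : ℕ∞)).card : ℝ) ≤
      ((∑ k ∈ range ℓ, d * (d - 1) ^ k : ℕ) : ℝ) := by exact_mod_cast h1
  rw [h2] at h3
  refine h3.trans ?_
  have h4 : (0 : ℝ) < d - 2 := by linarith
  rw [show (d : ℝ) - 1 - 1 = d - 2 by ring, div_mul_eq_mul_div, mul_div_assoc]
  gcongr
  linarith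

/-- Fact 5.8: upper bound on the number of edges seen by many vertices of `S`. -/
theorem stmt_14 {n d : ℕ} (hd : 3 ≤ d)
    (G : SimpleGraph (Fin n)) [DecidableRel G.Adj]
    (hreg : ∀ v, G.degree v = d)
    (S : Finset (Fin n)) (hS : S.Nonempty) (ℓ : ℕ) (hℓ : 1 ≤ ℓ)
    (ε L : ℝ) (hε : 0 < ε ∧ ε ≤ 1) (hL : 0 < L) :
    ((G.edgeFinset.filter fun e =>
        L * ((d : ℝ) - 1 - ε) ^ ℓ ≤
          ((S.filter fun v => edgeDist G v e ≤ ((ℓ - 1 : ℕ) : ℕ∞)).card : ℝ)).card : ℝ) ≤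
      S.card * ((d : ℝ) / (L * ((d : ℝ) - 2))) * (((d : ℝ) - 1) / ((d : ℝ) - 1 - ε)) ^ ℓ := by
  have hd' : (3 : ℝ) ≤ d := by exact_mod_cast hd
  have h2 : (0 : ℝ) < d - 2 := by linarith
  have h1 : (0 : ℝ) < d - 1 - ε := by linarith [hε.2]
  set T := G.edgeFinset.filter fun e =>
        L * ((d : ℝ) - 1 - ε) ^ ℓ ≤
          ((S.filter fun v => edgeDist G v e ≤ ((ℓ - 1 : ℕ) : ℕ∞)).card : ℝ) with hT
  have hlow : (T.card : ℝ) * (L * ((d : ℝ) - 1 - ε) ^ ℓ) ≤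
      ∑ e ∈ T, ((S.filter fun v => edgeDist G v e ≤ ((ℓ - 1 : ℕ) : ℕ∞)).card : ℝ) := by
    rw [← nsmul_eq_mul]
    exact card_nsmul_le_sum _ _ _ fun e he => (mem_filter.1 he).2
  have hswap : ∑ e ∈ T, ((S.filter fun v => edgeDist G v e ≤ ((ℓ - 1 : ℕ) : ℕ∞)).card : ℝ) =
      ∑ v ∈ S, ((T.filter fun e => edgeDist G v e ≤ ((ℓ - 1 : ℕ) : ℕ∞)).card : ℝ) := by
    simp only [card_filter, Nat.cast_sum]
    exact sum_comm
  have hup : ∑ v ∈ S, ((T.filter fun e => edgeDist G v e ≤ ((ℓ - 1 : ℕ) : ℕ∞)).card : ℝ) ≤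
      S.card * ((d : ℝ) / ((d : ℝ) - 2) * ((d : ℝ) - 1) ^ ℓ) := by
    rw [← nsmul_eq_mul]
    refine sum_le_card_nsmul _ _ _ fun v _ => ?_
    refine le_trans ?_ (card_edgeBall hd G hreg v ℓ hℓ)
    exact_mod_cast card_le_card (filter_subset_filter _ (filter_subset _ _))
  have hpos : 0 < L * ((d : ℝ) - 1 - ε) ^ ℓ := by positivity
  have hfin := (hlow.trans_eq hswap).trans hup
  rw [← le_div_iff₀ hpos] at hfin
  refine hfin.trans_eq ?_
  rw [div_pow]
  field_simp
end
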